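/- arXiv:2303.07691 — 3 statements merged into one kernel-verified Lean document; each statement's English description precedes it below -/
import Mathlib

section
/- Let X be a real Banach space and Y ⊆ X* a linear subspace. Then Ienv(Y) = { η ∈ X* : for every sequence (x_n) in the closed unit ball of X, if ξ(x_n) → 0 for every ξ ∈ Y, then η(x_n) → 0 }. -/
open Filter Topology

noncomputable section

/-- The weak* topology on the dual of `E`: pointwise convergence on `E`. -/
def wstarTop (E : Type*) [NormedAddCommGroup E] [NormedSpace ℝ E] :
    TopologicalSpace (E →L[ℝ] ℝ) :=
  TopologicalSpace.induced (fun f (x : E) => f x) Pi.topologicalSpace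

/-- Weak* closure of a set of functionals. -/
def wstarClosure {E : Type*} [NormedAddCommGroup E] [NormedSpace ℝ E]
    (A : Set (E →L[ℝ] ℝ)) : Set (E →L[ℝ] ℝ) :=
  @closure _ (wstarTop E) A

/-- The (I)-envelope of a set in a dual Banach space. -/
def Ienv {E : Type*} [NormedAddCommGroup E] [NormedSpace ℝ E]
    (A : Set (E →L[ℝ] ℝ)) : Set (E →L[ℝ] ℝ) :=
  ⋂ (As : ℕ → Set (E →L[ℝ] ℝ)) (_ : A = ⋃ n, As n),
    closure (convexHull ℝ (⋃ n, wstarClosure (convexHull ℝ (As n))))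

/-- `B₁(E)`: elements of the bidual that are weak* limits of sequences from `E`. -/
def B1 (E : Type*) [NormedAddCommGroup E] [NormedSpace ℝ E] :
    Set ((E →L[ℝ] ℝ) →L[ℝ] ℝ) :=
  {F | ∃ x : ℕ → E, ∀ ξ : E →L[ℝ] ℝ,
    Tendsto (fun n => ξ (x n)) atTop (𝓝 (F ξ))}

/-- `C(E)`: elements of the bidual lying in the weak* closure of a countable subset of `E`. -/
def CX (E : Type*) [NormedAddCommGroup E] [NormedSpace ℝ E] :
    Set ((E →L[ℝ] ℝ) →L[ℝ] ℝ) :=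
  {F | ∃ C : Set E, C.Countable ∧
    F ∈ wstarClosure ((fun x => NormedSpace.inclusionInDoubleDual ℝ E x) '' C)}

/-- The topology `σ(E*, Y)` for a set `Y` of elements of the bidual. -/
def sigmaTop {E : Type*} [NormedAddCommGroup E] [NormedSpace ℝ E]
    (Y : Set ((E →L[ℝ] ℝ) →L[ℝ] ℝ)) : TopologicalSpace (E →L[ℝ] ℝ) :=
  TopologicalSpace.induced
    (fun f (y : Y) => (y : (E →L[ℝ] ℝ) →L[ℝ] ℝ) f) Pi.topologicalSpace

end


theorem aux_join {V : Type*} [AddCommGroup V] [Module ℝ V] [TopologicalSpace V]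
    [IsTopologicalAddGroup V] [ContinuousSMul ℝ V] {K L C : Set V}
    (hK : IsCompact K) (hKc : Convex ℝ K) (hL : IsCompact L) (hLc : Convex ℝ L)
    (hC : Convex ℝ C) (hKC : K ⊆ C) (hLC : L ⊆ C) :
    ∃ M, IsCompact M ∧ Convex ℝ M ∧ M ⊆ C ∧ K ⊆ M ∧ L ⊆ M := by
  rcases K.eq_empty_or_nonempty with rfl | hKn
  · exact ⟨L, hL, hLc, hLC, Set.empty_subset _, subset_rfl⟩
  rcases L.eq_empty_or_nonempty with rfl | hLn
  · exact ⟨K, hK, hKc, hKC, subset_rfl, Set.empty_subset _⟩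
  refine ⟨convexHull ℝ (K ∪ L), ?_, convex_convexHull _ _,
    convexHull_min (Set.union_subset hKC hLC) hC,
    Set.subset_union_left.trans (subset_convexHull _ _),
    Set.subset_union_right.trans (subset_convexHull _ _)⟩
  have h : convexHull ℝ (K ∪ L) =
      (fun p : ℝ × V × V => (1 - p.1) • p.2.1 + p.1 • p.2.2) ''
        (Set.Icc (0:ℝ) 1 ×ˢ K ×ˢ L) := by
    rw [hKc.convexHull_union hLc hKn hLn]
    ext v
    simp only [mem_convexJoin, segment_eq_image, Set.mem_image, Set.mem_prod, Prod.exists]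
    constructor
    · rintro ⟨a, ha, b, hb, t, ht, rfl⟩
      exact ⟨t, a, b, ⟨ht, ha, hb⟩, rfl⟩
    · rintro ⟨t, a, b, ⟨ht, ha, hb⟩, rfl⟩
      exact ⟨a, ha, b, hb, t, ht, rfl⟩
  rw [h]
  exact (isCompact_Icc.prod (hK.prod hL)).image (by fun_prop)

theorem aux_hull {V : Type*} [AddCommGroup V] [Module ℝ V] [TopologicalSpace V]
    [IsTopologicalAddGroup V] [ContinuousSMul ℝ V] {L : ℕ → Set V} {C : Set V}
    (hL : ∀ i, IsCompact (L i)) (hLc : ∀ i, Convex ℝ (L i))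
    (hC : Convex ℝ C) (hLC : ∀ i, L i ⊆ C) (n : ℕ) :
    ∃ M, IsCompact M ∧ Convex ℝ M ∧ M ⊆ C ∧ ∀ i < n, L i ⊆ M := by
  induction n with
  | zero => exact ⟨∅, isCompact_empty, convex_empty, Set.empty_subset _, by simp⟩
  | succ n ih =>
    obtain ⟨K, h1, h2, h3, h4⟩ := ih
    obtain ⟨M, m1, m2, m3, m4, m5⟩ := aux_join h1 h2 (hL n) (hLc n) hC h3 (hLC n)
    refine ⟨M, m1, m2, m3, fun i hi => ?_⟩
    rcases Nat.lt_succ_iff_lt_or_eq.1 hi with h | rfl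
    · exact (h4 i h).trans m4
    · exact m5

theorem aux_sep {X : Type*} [NormedAddCommGroup X] [NormedSpace ℝ X]
    {K : Set (WeakDual ℝ X)} (hK : IsCompact K) (hKc : Convex ℝ K)
    (η : X →L[ℝ] ℝ) {c : ℝ} (hc : 0 < c)
    (hd : ∀ ξ ∈ K, c < ‖(WeakDual.toStrongDual ξ : X →L[ℝ] ℝ) - η‖) :
    ∃ x : X, ‖x‖ ≤ 1 ∧ ∀ ξ ∈ K, ξ x + c ≤ η x := by
  rcases K.eq_empty_or_nonempty with rfl | ⟨ξ₀, hξ₀⟩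
  · exact ⟨0, by simp, by simp⟩
  have hB : Convex ℝ (WeakDual.toStrongDual ⁻¹' Metric.closedBall (η : StrongDual ℝ X) c) :=
    (convex_closedBall (η : StrongDual ℝ X) c).linear_preimage
      (WeakDual.toStrongDual (𝕜 := ℝ) (E := X)).toLinearMap
  have hdisj : Disjoint K
      (WeakDual.toStrongDual ⁻¹' Metric.closedBall (η : StrongDual ℝ X) c) := by
    rw [Set.disjoint_left]
    intro ξ h1 h2
    have := hd ξ h1
    rw [Set.mem_preimage, Metric.mem_closedBall, dist_eq_norm] at h2
    exact absurd h2 (not_le.2 this)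
  have : LocallyConvexSpace ℝ (WeakDual ℝ X) :=
    inferInstanceAs (LocallyConvexSpace ℝ (WeakBilin (topDualPairing ℝ X)))
  obtain ⟨f, u, v, h1, huv, h2⟩ := geometric_hahn_banach_compact_closed hKc hK hB
    (WeakDual.isClosed_closedBall η c) hdisj
  obtain ⟨x, hx⟩ : ∃ x : X, ∀ ξ : WeakDual ℝ X, f ξ = ξ x := by
    obtain ⟨x, hx⟩ := LinearMap.dualEmbedding_surjective (topDualPairing ℝ X) f
    exact ⟨x, fun ξ => by rw [← hx]; rfl⟩
  obtain ⟨g, hg1, hg2⟩ := exists_dual_vector'' ℝ x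
  have hb : v < η x - c * ‖x‖ := by
    have := h2 (StrongDual.toWeakDual (η - c • g)) (by
      rw [Set.mem_preimage, Metric.mem_closedBall, dist_eq_norm]
      change ‖(η - c • g) - η‖ ≤ c
      rw [sub_sub_cancel_left, norm_neg, norm_smul, Real.norm_of_nonneg hc.le]
      nlinarith)
    rw [hx] at this
    have e : (StrongDual.toWeakDual (η - c • g)) x = η x - c * ‖x‖ := by
      have : g x = ‖x‖ := hg2
      rw [← this]; rfl
    rwa [e] at this
  have hx0 : x ≠ 0 := by
    rintro rfl
    have := h1 _ hξ₀
    rw [hx] at this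
    simp at this hb
    linarith
  have hn : 0 < ‖x‖ := norm_pos_iff.2 hx0
  refine ⟨‖x‖⁻¹ • x, by rw [norm_smul, norm_inv, norm_norm, inv_mul_cancel₀ hn.ne'], ?_⟩
  intro ξ hξ
  have := h1 ξ hξ
  rw [hx] at this
  rw [map_smul, map_smul, smul_eq_mul, smul_eq_mul]
  have h3 : ξ x + c * ‖x‖ ≤ η x := by linarith
  have h4 := mul_le_mul_of_nonneg_left h3 (inv_nonneg.2 hn.le)
  have h5 : ‖x‖⁻¹ * (ξ x + c * ‖x‖) = ‖x‖⁻¹ * ξ x + c := by field_simp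
  linarith

theorem aux_wclosed {X : Type*} [NormedAddCommGroup X] [NormedSpace ℝ X]
    (x : ℕ → X) (ε : ℝ) (m : ℕ) {A : Set (X →L[ℝ] ℝ)}
    (hA : A ⊆ {ξ | ∀ n ≥ m, |ξ (x n)| ≤ ε}) :
    wstarClosure A ⊆ {ξ | ∀ n ≥ m, |ξ (x n)| ≤ ε} := by
  letI := wstarTop X
  refine closure_minimal hA ?_
  have hc : Continuous (fun (f : X →L[ℝ] ℝ) (x : X) => f x) := continuous_induced_dom
  have : {ξ : X →L[ℝ] ℝ | ∀ n ≥ m, |ξ (x n)| ≤ ε} =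
      ⋂ n, ⋂ (_ : n ≥ m), {ξ : X →L[ℝ] ℝ | |ξ (x n)| ≤ ε} := by
    ext; simp
  rw [this]
  refine isClosed_iInter fun n => isClosed_iInter fun _ => ?_
  exact isClosed_le (((continuous_apply (x n)).comp hc).abs) continuous_const

theorem aux_convex {X : Type*} [NormedAddCommGroup X] [NormedSpace ℝ X]
    (x : ℕ → X) (ε : ℝ) (m : ℕ) :
    Convex ℝ {ξ : X →L[ℝ] ℝ | ∀ n ≥ m, |ξ (x n)| ≤ ε} := by
  intro a ha b hb s t hs ht hst n hn
  have h1 := ha n hn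
  have h2 := hb n hn
  simp only [add_apply, smul_apply, smul_eq_mul]
  rw [abs_le] at *
  constructor <;> nlinarith

theorem stmt2 {X : Type*} [NormedAddCommGroup X] [NormedSpace ℝ X] [CompleteSpace X]
    (Y : Submodule ℝ (X →L[ℝ] ℝ)) :
    Ienv (Y : Set (X →L[ℝ] ℝ)) =
      {η : X →L[ℝ] ℝ | ∀ x : ℕ → X, (∀ n, ‖x n‖ ≤ 1) →
        (∀ ξ ∈ Y, Tendsto (fun n => ξ (x n)) atTop (𝓝 0)) →
        Tendsto (fun n => η (x n)) atTop (𝓝 0)} := by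
  apply Set.Subset.antisymm
  · intro η hη x hx1 hxY
    rw [Metric.tendsto_atTop]
    intro ε hε
    have hη' := Set.mem_iInter₂.1 hη
      (fun m => {ξ | ξ ∈ Y ∧ ∀ n ≥ m, |ξ (x n)| ≤ ε / 2}) (by
        ext ξ
        simp only [Set.mem_iUnion, Set.mem_setOf_eq, SetLike.mem_coe]
        constructor
        · intro h
          obtain ⟨N, hN⟩ := (Metric.tendsto_atTop.1 (hxY ξ h)) (ε / 2) (by positivity)
          exact ⟨N, h, fun n hn => by simpa using (hN n hn).le⟩
        · rintro ⟨_, h, _⟩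
          exact h)
    have hsub : convexHull ℝ (⋃ m, wstarClosure (convexHull ℝ
        {ξ : X →L[ℝ] ℝ | ξ ∈ Y ∧ ∀ n ≥ m, |ξ (x n)| ≤ ε / 2})) ⊆
        ⋃ m, {ξ : X →L[ℝ] ℝ | ∀ n ≥ m, |ξ (x n)| ≤ ε / 2} := by
      refine convexHull_min (Set.iUnion_mono fun m => aux_wclosed x _ m ?_) ?_
      · exact convexHull_min (fun ξ h => h.2) (aux_convex x _ m)
      · refine Directed.convex_iUnion ?_ (fun {m} => aux_convex x _ m)
        refine Monotone.directed_le fun m k hmk ξ h n hn => h n (le_trans hmk hn)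
    obtain ⟨ξ, hξ, hd⟩ := Metric.mem_closure_iff.1 hη' (ε / 2) (by positivity)
    obtain ⟨m, hm⟩ := Set.mem_iUnion.1 (hsub hξ)
    refine ⟨m, fun n hn => ?_⟩
    have h1 := hm n hn
    rw [dist_eq_norm] at hd
    have h2 : |(η - ξ) (x n)| ≤ ‖η - ξ‖ := by
      have := (η - ξ).le_opNorm (x n)
      rw [Real.norm_eq_abs] at this
      nlinarith [hx1 n, norm_nonneg (η - ξ)]
    rw [Real.dist_eq, sub_zero]
    have h3 : η (x n) = (η - ξ) (x n) + ξ (x n) := by simp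
    rw [h3]
    linarith [abs_add_le ((η - ξ) (x n)) (ξ (x n))]
  · intro η hη
    refine Set.mem_iInter₂.2 fun As hAs => ?_
    by_contra hcl
    set C := convexHull ℝ (⋃ n, wstarClosure (convexHull ℝ (As n))) with hCdef
    rw [Metric.mem_closure_iff] at hcl
    push Not at hcl
    obtain ⟨c, hc, hcd⟩ := hcl
    have key : ∀ n : ℕ, ∃ x : X, ‖x‖ ≤ 1 ∧ ∀ i < n, ∀ ξ ∈ As i, ‖ξ‖ ≤ n →
        ξ x + c / 2 ≤ η x := by
      intro n
      let L : ℕ → Set (WeakDual ℝ X) := fun i =>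
        closure (WeakDual.toStrongDual ⁻¹' (convexHull ℝ (As i))) ∩
          WeakDual.toStrongDual ⁻¹' Metric.closedBall (0 : StrongDual ℝ X) n
      obtain ⟨M, m1, m2, m3, m4⟩ := aux_hull (L := L)
        (C := WeakDual.toStrongDual ⁻¹' C)
        (fun i => (WeakDual.isCompact_closedBall 0 _).inter_left isClosed_closure)
        (fun i => ((convex_convexHull ℝ (As i)).linear_preimage
            (WeakDual.toStrongDual (𝕜 := ℝ) (E := X)).toLinearMap).closure.inter
          ((convex_closedBall (0 : StrongDual ℝ X) n).linear_preimage
            (WeakDual.toStrongDual (𝕜 := ℝ) (E := X)).toLinearMap))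
        ((convex_convexHull ℝ _).linear_preimage
            (WeakDual.toStrongDual (𝕜 := ℝ) (E := X)).toLinearMap)
        (fun i ξ h => by
          have h' : (WeakDual.toStrongDual ξ : X →L[ℝ] ℝ) ∈
              ⋃ n, wstarClosure (convexHull ℝ (As n)) := Set.mem_iUnion.2 ⟨i, h.1⟩
          exact subset_convexHull ℝ (⋃ n, wstarClosure (convexHull ℝ (As n))) h') n
      obtain ⟨x, hx, hx2⟩ := aux_sep m1 m2 η (half_pos hc) (fun ξ hξ => by
        have := hcd (WeakDual.toStrongDual ξ : X →L[ℝ] ℝ) (m3 hξ)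
        rw [dist_comm, dist_eq_norm] at this
        linarith)
      refine ⟨x, hx, fun i hi ξ hξ hn => ?_⟩
      refine hx2 (StrongDual.toWeakDual ξ) (m4 i hi ⟨subset_closure ?_, ?_⟩)
      · exact subset_convexHull ℝ (As i) hξ
      · exact mem_closedBall_zero_iff.2 hn
    choose x hx1 hx2 using key
    have ev : ∀ ξ ∈ Y, ∀ᶠ n in atTop, ξ (x n) + c / 2 ≤ η (x n) := by
      intro ξ hξ
      have : ξ ∈ ⋃ n, As n := hAs ▸ hξ
      obtain ⟨i, hi⟩ := Set.mem_iUnion.1 this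
      filter_upwards [eventually_gt_atTop i, eventually_ge_atTop ⌈‖ξ‖⌉₊] with n h1 h2
      exact hx2 n i h1 ξ hi (Nat.ceil_le.1 h2)
    have bd : ∀ n, η (x n) ≤ ‖η‖ := by
      intro n
      have := η.le_opNorm (x n)
      rw [Real.norm_eq_abs] at this
      nlinarith [hx1 n, norm_nonneg η, le_abs_self (η (x n))]
    have up : ∀ ξ ∈ Y, ∀ ε > 0, ∀ᶠ n in atTop, ξ (x n) < ε := by
      intro ξ hξ ε hε
      filter_upwards [ev (((‖η‖ + 1) / ε) • ξ) (Y.smul_mem _ hξ)] with n hn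
      have hb := bd n
      rw [smul_apply, smul_eq_mul] at hn
      have hp : 0 < (‖η‖ + 1) / ε := by positivity
      by_contra hcon
      push Not at hcon
      have := mul_le_mul_of_nonneg_left hcon hp.le
      rw [div_mul_cancel₀ _ hε.ne'] at this
      linarith
    have hlim := hη x hx1 (fun ξ hξ => by
      rw [Metric.tendsto_nhds]
      intro ε hε
      filter_upwards [up ξ hξ ε hε, up (-ξ) (Y.neg_mem hξ) ε hε] with n h1 h2
      rw [Real.dist_eq, sub_zero, abs_lt]
      rw [neg_apply] at h2
      constructor <;> linarith)
    have h0 := ev 0 Y.zero_mem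
    have h1 := hlim.eventually (gt_mem_nhds (half_pos hc))
    obtain ⟨n, hn0, hn1⟩ := (h0.and h1).exists
    simp at hn0
    linarith
end

section
/- Let X be a real Banach space that contains no isomorphic copy of ℓ¹, i.e., there is no continuous linear map T : ℓ¹ → X that is bounded below (∃ c > 0 with ‖T f‖ ≥ c‖f‖ for all f ∈ ℓ¹). Then B₁(X) = C(X). -/
open Filter Topology

/-- The real Banach space `ℓ¹` of absolutely summable real sequences. -/
abbrev ellOne : Type := lp (fun _ : ℕ => ℝ) 1


theorem compact_convexJoin {E : Type*} [AddCommGroup E] [Module ℝ E] [TopologicalSpace E]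
    [ContinuousAdd E] [ContinuousSMul ℝ E] {s t : Set E} (hs : IsCompact s) (ht : IsCompact t) :
    IsCompact (convexJoin ℝ s t) := by
  have h : convexJoin ℝ s t =
      (fun q : ℝ × E × E => (1 - q.1) • q.2.1 + q.1 • q.2.2) '' (Set.Icc (0:ℝ) 1 ×ˢ (s ×ˢ t)) := by
    ext z
    simp only [mem_convexJoin, segment_eq_image, Set.mem_image, Set.mem_prod, Prod.exists]
    constructor
    · rintro ⟨x, hx, y, hy, r, hr, rfl⟩
      exact ⟨r, x, y, ⟨hr, hx, hy⟩, rfl⟩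
    · rintro ⟨r, x, y, ⟨hr, hx, hy⟩, rfl⟩
      exact ⟨x, hx, y, hy, r, hr, rfl⟩
  rw [h]
  refine (isCompact_Icc.prod (hs.prod ht)).image ?_
  fun_prop

theorem wd_functional {Y : Type*} [NormedAddCommGroup Y] [NormedSpace ℝ Y]
    (g : WeakDual ℝ Y →L[ℝ] ℝ) : ∃ x : Y, ∀ p : WeakDual ℝ Y, g p = p x := by
  obtain ⟨x, hx⟩ := LinearMap.dualEmbedding_surjective (topDualPairing ℝ Y) g
  exact ⟨x, fun p => by rw [← hx]; rfl⟩

/-- finite systems of inequalities on weak* compact convex sets. -/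
theorem helly_lemma {Y : Type*} [NormedAddCommGroup Y] [NormedSpace ℝ Y]
    (f : WeakDual ℝ Y →ₗ[ℝ] ℝ) {ι : Type*} (C : ι → Set (WeakDual ℝ Y)) (d : ι → ℝ)
    (hC : ∀ i, IsCompact (C i)) (hc : ∀ i, Convex ℝ (C i)) (hf : ∀ i, ∀ p ∈ C i, f p ≤ d i)
    (s : Finset ι) (i₀ : ι) (h0 : (0 : WeakDual ℝ Y) ∈ C i₀)
    (δ : ℝ) (hδ : 0 < δ) : ∃ x : Y, ∀ i ∈ s, ∀ p ∈ C i, p x ≤ d i + δ := by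
  classical
  have key : ∃ W : Set (WeakDual ℝ Y × ℝ), IsCompact W ∧ Convex ℝ W ∧ (∀ q ∈ W, f q.1 ≤ q.2) ∧
      (0, d i₀) ∈ W ∧ ∀ i ∈ s, ∀ p ∈ C i, (p, d i) ∈ W := by
    induction s using Finset.induction_on with
    | empty =>
      refine ⟨C i₀ ×ˢ {d i₀}, (hC _).prod isCompact_singleton, (hc _).prod (convex_singleton _), ?_,
        by simp [h0], by simp⟩
      rintro ⟨p, t⟩ ⟨h1, h2⟩
      simp only [Set.mem_singleton_iff] at h2
      subst h2
      exact hf _ _ h1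
    | insert j s hj ih =>
      obtain ⟨W, hW1, hW2, hW3, hW4, hW5⟩ := ih
      by_cases hne : (C j).Nonempty
      · have hne' : (C j ×ˢ {d j}).Nonempty := hne.prod (Set.singleton_nonempty _)
        have hsub := subset_convexJoin_left (𝕜 := ℝ) (s := W) hne'
        have hsub' := subset_convexJoin_right (𝕜 := ℝ) (t := C j ×ˢ {d j}) (s := W) ⟨_, hW4⟩
        refine ⟨convexJoin ℝ W (C j ×ˢ {d j}),
          compact_convexJoin hW1 ((hC _).prod isCompact_singleton),
          hW2.convexJoin ((hc _).prod (convex_singleton _)), ?_, hsub hW4, ?_⟩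
        · intro q hq
          obtain ⟨x, hx, y, hy, a, b, ha, hb, hab, rfl⟩ := mem_convexJoin.1 hq
          have h1 := hW3 x hx
          have h2 : f y.1 ≤ y.2 := by
            obtain ⟨h3, h4⟩ := hy
            simp only [Set.mem_singleton_iff] at h4
            rw [h4]
            exact hf _ _ h3
          simp only [Prod.fst_add, Prod.snd_add, Prod.smul_fst, Prod.smul_snd, map_add, map_smul,
            smul_eq_mul]
          gcongr
        · intro i hi p hp
          rcases Finset.mem_insert.1 hi with rfl | hi
          · exact hsub' ⟨hp, rfl⟩
          · exact hsub (hW5 i hi p hp)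
      · refine ⟨W, hW1, hW2, hW3, hW4, ?_⟩
        intro i hi p hp
        rcases Finset.mem_insert.1 hi with rfl | hi
        · exact absurd ⟨p, hp⟩ hne
        · exact hW5 i hi p hp
  obtain ⟨W, hW1, hW2, hW3, hW4, hW5⟩ := key
  have : LocallyConvexSpace ℝ (WeakDual ℝ Y) :=
    WeakBilin.locallyConvexSpace (B := topDualPairing ℝ Y)
  obtain ⟨φ, u, v, h1, h2, h3⟩ := geometric_hahn_banach_compact_closed hW2 hW1
    (t := ({0} : Set (WeakDual ℝ Y)) ×ˢ Set.Iic (-δ))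
    ((convex_singleton _).prod (convex_Iic _)) (isClosed_singleton.prod isClosed_Iic) (by
      rw [Set.disjoint_left]
      rintro ⟨p, t⟩ hq ⟨hp, ht⟩
      simp only [Set.mem_singleton_iff, Set.mem_Iic] at hp ht
      have := hW3 _ hq
      simp only [hp, map_zero] at this
      linarith)
  obtain ⟨x, hx⟩ := wd_functional (φ.comp (ContinuousLinearMap.inl ℝ (WeakDual ℝ Y) ℝ))
  set l := φ (0, 1) with hl
  have hφ : ∀ p t, φ (p, t) = p x + t * l := by
    intro p t
    have : ((p, t) : WeakDual ℝ Y × ℝ) = (p, 0) + t • (0, 1) := by simp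
    rw [this, map_add, map_smul, ← hx p]
    rfl
  have e1 := h1 _ hW4
  rw [hφ] at e1
  have e0 : (0 : WeakDual ℝ Y) x = 0 := rfl
  have e2 : ∀ r ≥ δ, v < - r * l := by
    intro r hr
    have := h3 (0, -r) ⟨rfl, by simpa using hr⟩
    rw [hφ, e0] at this
    linarith
  rw [e0] at e1
  have e3 := e2 δ le_rfl
  have hd : 0 ≤ d i₀ := by simpa using hf i₀ 0 h0
  have hl0 : l < 0 := by
    by_contra hcon
    push Not at hcon
    nlinarith [mul_nonneg hd hcon, mul_nonneg hδ.le hcon]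
  refine ⟨(-l)⁻¹ • x, fun i hi p hp => ?_⟩
  have e4 := h1 _ (hW5 i hi p hp)
  rw [hφ] at e4
  rw [map_smul, smul_eq_mul, inv_mul_le_iff₀ (by linarith)]
  nlinarith

/-- unit ball of the dual. -/
def UB (Y : Type*) [NormedAddCommGroup Y] [NormedSpace ℝ Y] : Set (WeakDual ℝ Y) :=
  {p | ∀ x, p x ≤ ‖x‖}

theorem UB_neg {Y : Type*} [NormedAddCommGroup Y] [NormedSpace ℝ Y] {p : WeakDual ℝ Y}
    (hp : p ∈ UB Y) : -p ∈ UB Y := by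
  intro x
  have h := hp (-x)
  rw [map_neg, norm_neg] at h
  exact h

theorem UB_zero {Y : Type*} [NormedAddCommGroup Y] [NormedSpace ℝ Y] :
    (0 : WeakDual ℝ Y) ∈ UB Y := fun x => norm_nonneg x

theorem UB_compact {Y : Type*} [NormedAddCommGroup Y] [NormedSpace ℝ Y] : IsCompact (UB Y) := by
  have h : UB Y = WeakDual.toStrongDual ⁻¹' Metric.closedBall (0 : StrongDual ℝ Y) 1 := by
    ext p
    simp only [Set.mem_preimage, mem_closedBall_zero_iff]
    constructor
    · intro hp
      refine ContinuousLinearMap.opNorm_le_bound _ zero_le_one fun x => ?_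
      rw [one_mul, Real.norm_eq_abs, abs_le]
      exact ⟨by have := UB_neg hp x; change - (p x) ≤ _ at this; change - ‖x‖ ≤ p x; linarith, hp x⟩
    · intro hp x
      have := ContinuousLinearMap.le_of_opNorm_le _ hp x
      rw [one_mul] at this
      exact (le_abs_self _).trans this
  rw [h]
  exact WeakDual.isCompact_closedBall 0 1

theorem UB_convex {Y : Type*} [NormedAddCommGroup Y] [NormedSpace ℝ Y] : Convex ℝ (UB Y) := by
  intro p hp q hq a b ha hb hab x
  have h1 := mul_le_mul_of_nonneg_left (hp x) ha
  have h2 := mul_le_mul_of_nonneg_left (hq x) hb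
  change a * p x + b * q x ≤ _
  calc a * p x + b * q x ≤ (a + b) * ‖x‖ := by linarith
    _ = ‖x‖ := by rw [hab, one_mul]

theorem UB_norm {Y : Type*} [NormedAddCommGroup Y] [NormedSpace ℝ Y] (x : Y) (r : ℝ)
    (h : ∀ p ∈ UB Y, p x ≤ r) : ‖x‖ ≤ r := by
  obtain ⟨g, hg, hgx⟩ := exists_dual_vector'' ℝ x
  have := h (StrongDual.toWeakDual g) (fun y => by
    have := ContinuousLinearMap.le_of_opNorm_le _ hg y
    rw [one_mul] at this
    exact (le_abs_self _).trans this)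
  have h2 : g x ≤ r := this
  rw [hgx] at h2
  exact h2

theorem UB_abs {Y : Type*} [NormedAddCommGroup Y] [NormedSpace ℝ Y] {p : WeakDual ℝ Y}
    (hp : p ∈ UB Y) (x : Y) : |p x| ≤ ‖x‖ := by
  rw [abs_le]
  exact ⟨by have := UB_neg hp x; change - (p x) ≤ _ at this; linarith, hp x⟩

theorem goldstine_dense {Y : Type*} [NormedAddCommGroup Y] [NormedSpace ℝ Y]
    (f : WeakDual ℝ Y →ₗ[ℝ] ℝ) (M : ℝ) (hM : ∀ p ∈ UB Y, f p ≤ M)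
    (e : ℕ → Y) (he : DenseRange e) (P : Finset (WeakDual ℝ Y)) (hP : ∀ p ∈ P, p ∈ UB Y)
    (δ : ℝ) (hδ : 0 < δ) : ∃ n, ‖e n‖ ≤ M + δ ∧ ∀ p ∈ P, |p (e n) - f p| < δ := by
  classical
  obtain ⟨x, hx⟩ := helly_lemma f (ι := WeakDual ℝ Y ⊕ Unit)
    (Sum.elim (fun p => {p}) (fun _ => UB Y)) (Sum.elim (fun p => f p) (fun _ => M))
    (by rintro (p | u); exacts [isCompact_singleton, UB_compact])
    (by rintro (p | u); exacts [convex_singleton _, UB_convex])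
    (by
      rintro (p | u) q hq
      · simp only [Sum.elim_inl, Set.mem_singleton_iff] at hq
        simp [hq]
      · exact hM q hq)
    ((P ∪ P.image (fun p => -p)).disjSum {()}) (Sum.inr ()) UB_zero (δ / 3) (by positivity)
  have hx1 : ‖x‖ ≤ M + δ / 3 := UB_norm x _ (fun p hp => hx (Sum.inr ()) (by simp) p hp)
  have hx2 : ∀ p ∈ P, |p x - f p| ≤ δ / 3 := by
    intro p hp
    have h1 := hx (Sum.inl p) (by simp [hp]) p rfl
    have h2 := hx (Sum.inl (-p)) (by simp [hp]) (-p) rfl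
    simp only [Sum.elim_inl, map_neg] at h1 h2
    change - (p x) ≤ _ at h2
    rw [abs_le]
    constructor <;> linarith
  obtain ⟨n, hn⟩ := he.exists_dist_lt x (show 0 < δ / 3 by positivity)
  rw [dist_eq_norm] at hn
  refine ⟨n, ?_, fun p hp => ?_⟩
  · have := norm_sub_norm_le (e n) x
    rw [norm_sub_rev] at this
    linarith
  · have h1 := UB_abs (hP p hp) (x - e n)
    have h2 := hx2 p hp
    rw [map_sub, abs_le] at h1
    rw [abs_le] at h2
    rw [abs_lt]
    constructor <;> linarith

theorem ell_one_of_indep {Y : Type*} [NormedAddCommGroup Y] [NormedSpace ℝ Y] [CompleteSpace Y]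
    (x : ℕ → Y) (R : ℝ) (hR : ∀ n, ‖x n‖ ≤ R) (α β : ℝ) (hαβ : α < β)
    (h : ∀ F t : Finset ℕ, t ⊆ F → ∃ p ∈ UB Y, ∀ n ∈ F,
      (n ∈ t → β < p (x n)) ∧ (n ∉ t → p (x n) < α)) :
    ∃ T : lp (fun _ : ℕ => ℝ) 1 →L[ℝ] Y, ∃ c : ℝ, 0 < c ∧ ∀ f : lp (fun _ : ℕ => ℝ) 1,
      c * ‖f‖ ≤ ‖T f‖ := by
  classical
  have hnorm : ∀ f : lp (fun _ : ℕ => ℝ) 1, HasSum (fun n => ‖f n‖) ‖f‖ := by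
    intro f
    have := lp.hasSum_norm (p := 1) (by simp) f
    simpa using this
  have hle : ∀ f : lp (fun _ : ℕ => ℝ) 1, ∀ n, ‖f n • x n‖ ≤ ‖f n‖ * R := by
    intro f n
    rw [norm_smul]
    exact mul_le_mul_of_nonneg_left (hR n) (norm_nonneg _)
  have hs : ∀ f : lp (fun _ : ℕ => ℝ) 1, Summable (fun n => f n • x n) := fun f =>
    Summable.of_norm_bounded ((hnorm f).summable.mul_right R) (hle f)
  let T0 : lp (fun _ : ℕ => ℝ) 1 →ₗ[ℝ] Y :=
    { toFun := fun f => ∑' n, f n • x n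
      map_add' := fun f g => by
        rw [← (hs f).tsum_add (hs g)]
        simp [add_smul]
      map_smul' := fun c f => by
        rw [RingHom.id_apply, ← (hs f).tsum_const_smul]
        simp [mul_smul] }
  let T := T0.mkContinuous R (fun f => by
    change ‖∑' n, f n • x n‖ ≤ _
    rw [mul_comm]
    exact tsum_of_norm_bounded ((hnorm f).mul_right R) (hle f))
  have hfin : ∀ (c : ℕ → ℝ) (F : Finset ℕ),
      (β - α) / 2 * ∑ n ∈ F, ‖c n‖ ≤ ‖∑ n ∈ F, c n • x n‖ := by
    intro c F
    obtain ⟨p, hp, hp'⟩ := h F (F.filter (fun n => 0 ≤ c n)) (Finset.filter_subset _ _)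
    obtain ⟨q, hq, hq'⟩ := h F (F.filter (fun n => ¬ 0 ≤ c n)) (Finset.filter_subset _ _)
    have h1 := UB_abs hp (∑ n ∈ F, c n • x n)
    have h2 := UB_abs hq (∑ n ∈ F, c n • x n)
    have h3 : (β - α) * ∑ n ∈ F, ‖c n‖ ≤ p (∑ n ∈ F, c n • x n) - q (∑ n ∈ F, c n • x n) := by
      rw [map_sum, map_sum, ← Finset.sum_sub_distrib, Finset.mul_sum]
      refine Finset.sum_le_sum fun n hn => ?_
      obtain ⟨a1, a2⟩ := hp' n hn
      obtain ⟨b1, b2⟩ := hq' n hn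
      simp only [Finset.mem_filter, hn, true_and, not_not] at a1 a2 b1 b2
      rw [map_smul, map_smul, smul_eq_mul, smul_eq_mul, Real.norm_eq_abs]
      by_cases hc : 0 ≤ c n
      · rw [abs_of_nonneg hc]
        nlinarith [a1 hc, b2 hc]
      · have := a2 hc
        have := b1 hc
        push Not at hc
        rw [abs_of_neg hc]
        nlinarith
    rw [abs_le] at h1 h2
    linarith
  refine ⟨T, (β - α) / 2, by linarith, fun f => ?_⟩
  exact le_of_tendsto_of_tendsto' ((hnorm f).const_mul ((β - α) / 2)) (hs f).hasSum.norm
    (fun F => hfin f F)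

/-- basic cells. -/
def cell {Y : Type*} [NormedAddCommGroup Y] [NormedSpace ℝ Y] (e : ℕ → Y) (α β : ℝ)
    (F t : Finset ℕ) : Set (WeakDual ℝ Y) :=
  {p | ∀ n ∈ F, (n ∈ t → β < p (e n)) ∧ (n ∉ t → p (e n) < α)}

theorem tree_lemma {Y : Type*} [NormedAddCommGroup Y] [NormedSpace ℝ Y] [CompleteSpace Y]
    (f : WeakDual ℝ Y →ₗ[ℝ] ℝ) (M : ℝ) (hM : ∀ p ∈ UB Y, f p ≤ M)
    (e : ℕ → Y) (he : DenseRange e) (a a' δ : ℝ) (hδ : 0 < δ) (haa : a + δ < a' - δ)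
    (A : Set (WeakDual ℝ Y)) (hA : A.Nonempty) (hAU : A ⊆ UB Y) (hAf : ∀ p ∈ A, f p ≤ a)
    (H : ∀ F t : Finset ℕ, (A ∩ cell e (a + δ) (a' - δ) F t).Nonempty →
      ∃ q ∈ UB Y, (∀ x r, (∀ p ∈ A ∩ cell e (a + δ) (a' - δ) F t, p x ≤ r) → q x ≤ r) ∧ a' < f q) :
    ∃ T : lp (fun _ : ℕ => ℝ) 1 →L[ℝ] Y, ∃ c : ℝ, 0 < c ∧ ∀ f : lp (fun _ : ℕ => ℝ) 1,
      c * ‖f‖ ≤ ‖T f‖ := by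
  classical
  let P : Finset ℕ → Prop := fun F => ∀ t ⊆ F, (A ∩ cell e (a + δ) (a' - δ) F t).Nonempty
  have step : ∀ F : {F // P F}, ∃ n, n ∉ F.1 ∧ ‖e n‖ ≤ M + δ ∧ P (insert n F.1) := by
    rintro ⟨F, hF⟩
    have hF' : ∀ t, t ⊆ F → ∃ p, p ∈ A ∩ cell e (a + δ) (a' - δ) F t := fun t ht => hF t ht
    have hQ : ∀ t, t ⊆ F → ∃ q, q ∈ UB Y ∧
      (∀ x r, (∀ p ∈ A ∩ cell e (a + δ) (a' - δ) F t, p x ≤ r) → q x ≤ r) ∧ a' < f q :=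
      fun t ht => H F t (hF t ht)
    choose! p hp using hF'
    choose! q hq using hQ
    obtain ⟨n, hn1, hn2⟩ := goldstine_dense f M hM e he
      (F.powerset.image p ∪ F.powerset.image q) (by
        intro r hr
        simp only [Finset.mem_union, Finset.mem_image, Finset.mem_powerset] at hr
        rcases hr with ⟨t, ht, rfl⟩ | ⟨t, ht, rfl⟩
        · exact hAU (hp t ht).1
        · exact (hq t ht).1) δ hδ
    have hpn : ∀ t ⊆ F, p t (e n) < a + δ := by
      intro t ht
      have h1 := hn2 (p t) (Finset.mem_union_left _
        (Finset.mem_image_of_mem _ (Finset.mem_powerset.2 ht)))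
      have h2 := hAf _ (hp t ht).1
      rw [abs_lt] at h1
      linarith
    have hqn : ∀ t ⊆ F, ∃ r ∈ A ∩ cell e (a + δ) (a' - δ) F t, a' - δ < r (e n) := by
      intro t ht
      have h1 := hn2 (q t) (Finset.mem_union_right _
        (Finset.mem_image_of_mem _ (Finset.mem_powerset.2 ht)))
      obtain ⟨-, h2, h3⟩ := hq t ht
      by_contra hcon
      push Not at hcon
      have := h2 _ _ hcon
      rw [abs_lt] at h1
      linarith
    refine ⟨n, ?_, hn1, ?_⟩
    · intro hnF
      have h1 := ((hp F subset_rfl).2 n hnF).1 hnF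
      have h2 := hpn F subset_rfl
      linarith
    · intro t ht
      have ht0 : t.erase n ⊆ F := by
        intro m hm
        rw [Finset.mem_erase] at hm
        exact Finset.mem_of_mem_insert_of_ne (ht hm.2) hm.1
      have ext : ∀ r ∈ A ∩ cell e (a + δ) (a' - δ) F (t.erase n),
          ((n ∈ t → a' - δ < r (e n)) ∧ (n ∉ t → r (e n) < a + δ)) →
          (A ∩ cell e (a + δ) (a' - δ) (insert n F) t).Nonempty := by
        rintro r ⟨hr1, hr2⟩ hr3
        refine ⟨r, hr1, fun m hm => ?_⟩
        by_cases hmn : m = n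
        · rw [hmn]; exact hr3
        · have := hr2 m (Finset.mem_of_mem_insert_of_ne hm hmn)
          simpa [Finset.mem_erase, hmn] using this
      by_cases hnt : n ∈ t
      · obtain ⟨r, hr1, hr2⟩ := hqn _ ht0
        exact ext r hr1 ⟨fun _ => hr2, fun h => absurd hnt h⟩
      · exact ext _ (hp _ ht0) ⟨fun h => absurd h hnt, fun _ => hpn _ ht0⟩
  choose g hg1 hg2 hg3 using step
  have hP0 : P ∅ := by
    intro t ht
    obtain ⟨p, hp⟩ := hA
    exact ⟨p, hp, fun n hn => absurd hn (Finset.notMem_empty n)⟩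
  let S : ℕ → {F // P F} := fun k => Nat.rec ⟨∅, hP0⟩ (fun _ F => ⟨insert (g F) F.1, hg3 F⟩) k
  have hS : ∀ k, (S (k + 1)).1 = insert (g (S k)) (S k).1 := fun k => rfl
  have hmono : Monotone (fun k => (S k).1) := monotone_nat_of_le_succ (fun k => by
    rw [hS]; exact Finset.subset_insert _ _)
  have hmem : ∀ j k, j < k → g (S j) ∈ (S k).1 := by
    intro j k hjk
    apply hmono (Nat.succ_le_of_lt hjk)
    change _ ∈ (S (j + 1)).1
    rw [hS]
    exact Finset.mem_insert_self _ _
  have hinj : Function.Injective (fun k => g (S k)) := by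
    intro j k hjk
    by_contra hne
    rcases lt_or_gt_of_ne hne with h | h
    · exact hg1 (S k) (by have := hmem j k h; simp only at hjk; rwa [hjk] at this)
    · exact hg1 (S j) (by have := hmem k j h; simp only at hjk; rwa [← hjk] at this)
  refine ell_one_of_indep (fun k => e (g (S k))) (M + δ) (fun k => hg2 _) (a + δ) (a' - δ) haa ?_
  intro F t htF
  have hlt : ∀ k ∈ F, k < F.sup id + 1 := fun k hk =>
    Nat.lt_succ_of_le (Finset.le_sup (f := id) hk)
  obtain ⟨p, hp1, hp2⟩ := (S (F.sup id + 1)).2 (t.image (fun k => g (S k))) (by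
    intro m hm
    obtain ⟨k, hk, rfl⟩ := Finset.mem_image.1 hm
    exact hmem _ _ (hlt k (htF hk)))
  refine ⟨p, hAU hp1, fun k hk => ?_⟩
  have := hp2 (g (S k)) (hmem _ _ (hlt k hk))
  have hiff : g (S k) ∈ t.image (fun k => g (S k)) ↔ k ∈ t := by
    constructor
    · intro h
      obtain ⟨j, hj, hjk⟩ := Finset.mem_image.1 h
      rwa [← hinj hjk]
    · intro h
      exact Finset.mem_image_of_mem _ h
  rwa [hiff] at this

theorem cover_lemma {Y : Type*} [NormedAddCommGroup Y] [NormedSpace ℝ Y] [CompleteSpace Y]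
    (hY : ¬ ∃ T : lp (fun _ : ℕ => ℝ) 1 →L[ℝ] Y, ∃ c : ℝ, 0 < c ∧
      ∀ f : lp (fun _ : ℕ => ℝ) 1, c * ‖f‖ ≤ ‖T f‖)
    (f : WeakDual ℝ Y →ₗ[ℝ] ℝ) (M : ℝ) (hM : ∀ p ∈ UB Y, f p ≤ M)
    (e : ℕ → Y) (he : DenseRange e) (a a' : ℝ) (haa : a < a') :
    ∃ 𝒞 : Set (Set (WeakDual ℝ Y)), 𝒞.Countable ∧
      (∀ C ∈ 𝒞, IsCompact C ∧ Convex ℝ C ∧ ∀ p ∈ C, f p ≤ a') ∧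
      {p | p ∈ UB Y ∧ f p ≤ a} ⊆ ⋃₀ 𝒞 := by
  classical
  let J : Set (WeakDual ℝ Y) → Prop := fun S => ∃ 𝒞 : Set (Set (WeakDual ℝ Y)), 𝒞.Countable ∧
      (∀ C ∈ 𝒞, IsCompact C ∧ Convex ℝ C ∧ ∀ p ∈ C, f p ≤ a') ∧ S ⊆ ⋃₀ 𝒞
  set A : Set (WeakDual ℝ Y) := {p | p ∈ UB Y ∧ f p ≤ a} with hAdef
  set δ : ℝ := (a' - a) / 3 with hδ
  let U : Finset ℕ × Finset ℕ → Set (WeakDual ℝ Y) :=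
    fun i => cell e (a + δ) (a' - δ) i.1 i.2
  let Bad := {i | J (A ∩ U i)}
  have hBad : ∀ i : Bad, J (A ∩ U i) := fun i => i.2
  choose 𝒟 hD1 hD2 hD3 using hBad
  let 𝒟' := ⋃ i, 𝒟 i
  have hD'1 : 𝒟'.Countable := Set.countable_iUnion hD1
  have hD'2 : ∀ C ∈ 𝒟', IsCompact C ∧ Convex ℝ C ∧ ∀ p ∈ C, f p ≤ a' := by
    intro C hC
    obtain ⟨i, hi⟩ := Set.mem_iUnion.1 hC
    exact hD2 i C hi
  let A' := {p | p ∈ A ∧ ∀ i ∈ Bad, p ∉ U i}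
  have hAA : ∀ p ∈ A, p ∉ A' → p ∈ ⋃₀ 𝒟' := by
    intro p hp hp'
    have : ∃ i ∈ Bad, p ∈ U i := by
      by_contra hcon
      push Not at hcon
      exact hp' ⟨hp, hcon⟩
    obtain ⟨i, hi, hpi⟩ := this
    obtain ⟨C, hC, hpC⟩ := hD3 ⟨i, hi⟩ ⟨hp, hpi⟩
    exact ⟨C, Set.mem_iUnion.2 ⟨_, hC⟩, hpC⟩
  by_cases hne : A'.Nonempty
  · exfalso
    apply hY
    refine tree_lemma f M hM e he a a' δ (by rw [hδ]; linarith) (by rw [hδ]; linarith) A' hne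
      (fun p hp => hp.1.1) (fun p hp => hp.1.2) ?_
    intro F t hFt
    by_contra hcon
    push Not at hcon
    let Hl : Set (WeakDual ℝ Y) := {q | q ∈ UB Y ∧
      ∀ x r, (∀ p ∈ A' ∩ cell e (a + δ) (a' - δ) F t, p x ≤ r) → q x ≤ r}
    have hbad : (F, t) ∈ Bad := by
      refine ⟨insert Hl 𝒟', hD'1.insert _, ?_, ?_⟩
      · intro C hC
        rcases hC with rfl | hC
        · refine ⟨?_, ?_, fun p hp => hcon p hp.1 hp.2⟩
          · refine UB_compact.of_isClosed_subset ?_ (fun q hq => hq.1)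
            refine UB_compact.isClosed.inter ?_
            change IsClosed {q : WeakDual ℝ Y | ∀ x r, _ → _}
            simp only [Set.setOf_forall]
            refine isClosed_iInter fun x => isClosed_iInter fun r => isClosed_iInter fun _ => ?_
            exact isClosed_le (WeakDual.eval_continuous x) continuous_const
          · intro p hp q hq u v hu hv huv
            refine ⟨UB_convex hp.1 hq.1 hu hv huv, fun x r hxr => ?_⟩
            have h1 := mul_le_mul_of_nonneg_left (hp.2 x r hxr) hu
            have h2 := mul_le_mul_of_nonneg_left (hq.2 x r hxr) hv
            change u * p x + v * q x ≤ _
            calc u * p x + v * q x ≤ (u + v) * r := by linarith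
              _ = r := by rw [huv, one_mul]
        · exact hD'2 C hC
      · rintro p ⟨hp1, hp2⟩
        by_cases hp : p ∈ A'
        · exact ⟨Hl, Set.mem_insert _ _, hp1.1, fun x r h => h p ⟨hp, hp2⟩⟩
        · obtain ⟨C, hC, hpC⟩ := hAA p hp1 hp
          exact ⟨C, Set.mem_insert_of_mem _ hC, hpC⟩
    obtain ⟨p, hp1, hp2⟩ := hFt
    exact hp1.2 _ hbad hp2
  · refine ⟨𝒟', hD'1, hD'2, fun p hp => hAA p hp fun h => hne ⟨p, h⟩⟩

theorem separable_case {Y : Type*} [NormedAddCommGroup Y] [NormedSpace ℝ Y] [CompleteSpace Y]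
    (hY : ¬ ∃ T : lp (fun _ : ℕ => ℝ) 1 →L[ℝ] Y, ∃ c : ℝ, 0 < c ∧
      ∀ f : lp (fun _ : ℕ => ℝ) 1, c * ‖f‖ ≤ ‖T f‖)
    (f : WeakDual ℝ Y →ₗ[ℝ] ℝ) (M : ℝ) (hM : ∀ p ∈ UB Y, f p ≤ M)
    (e : ℕ → Y) (he : DenseRange e) :
    ∃ x : ℕ → Y, ∀ p ∈ UB Y, Tendsto (fun n => p (x n)) atTop (𝓝 (f p)) := by
  classical
  have hcov : ∀ r : {r : ℚ × ℚ // r.1 < r.2}, ∃ 𝒞 : Set (Set (WeakDual ℝ Y)), 𝒞.Countable ∧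
      (∀ C ∈ 𝒞, IsCompact C ∧ Convex ℝ C ∧ ∀ p ∈ C, f p ≤ (r.1.2 : ℝ)) ∧
      {p | p ∈ UB Y ∧ f p ≤ (r.1.1 : ℝ)} ⊆ ⋃₀ 𝒞 := fun r =>
    cover_lemma hY f M hM e he _ _ (by exact_mod_cast r.2)
  choose 𝒞 h1 h2 h3 using hcov
  have : ∀ r, Countable (𝒞 r) := fun r => (h1 r).to_subtype
  let ι := Option (Σ r, 𝒞 r)
  obtain ⟨E, hE⟩ := exists_surjective_nat ι
  let C : ι → Set (WeakDual ℝ Y) := fun i => i.elim (UB Y) (fun s => s.2.1)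
  let d : ι → ℝ := fun i => i.elim M (fun s => (s.1.1.2 : ℝ))
  have hx : ∀ n : ℕ, ∃ x : Y, ∀ i ∈ (Finset.range n).image E, ∀ p ∈ C i,
      p x ≤ d i + 1 / ((n : ℝ) + 1) := fun n =>
    helly_lemma f C d
      (by rintro (_ | ⟨r, D, hD⟩); exacts [UB_compact, (h2 r D hD).1])
      (by rintro (_ | ⟨r, D, hD⟩); exacts [UB_convex, (h2 r D hD).2.1])
      (by rintro (_ | ⟨r, D, hD⟩); exacts [hM, (h2 r D hD).2.2])
      _ none UB_zero _ (by positivity)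
  choose x hx using hx
  have upper : ∀ p ∈ UB Y, ∀ b, f p < b → ∀ᶠ n in atTop, p (x n) < b := by
    intro p hp b hb
    obtain ⟨r1, hr1, hr1'⟩ := exists_rat_btwn hb
    obtain ⟨r2, hr2, hr2'⟩ := exists_rat_btwn hr1'
    have hrr : r1 < r2 := by exact_mod_cast hr2
    obtain ⟨D, hD, hpD⟩ := h3 ⟨(r1, r2), hrr⟩ ⟨hp, hr1.le⟩
    obtain ⟨k, hk⟩ := hE (some ⟨⟨(r1, r2), hrr⟩, ⟨D, hD⟩⟩)
    have ht : ∀ᶠ n : ℕ in atTop, 1 / ((n : ℝ) + 1) < b - r2 :=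
      tendsto_one_div_add_atTop_nhds_zero_nat.eventually_lt_const (by linarith)
    filter_upwards [ht, eventually_gt_atTop k] with n hn1 hn2
    have := hx n (E k) (Finset.mem_image_of_mem _ (Finset.mem_range.2 hn2)) p
      (by rw [hk]; exact hpD)
    rw [hk] at this
    change _ ≤ (r2 : ℝ) + _ at this
    linarith
  refine ⟨x, fun p hp => tendsto_order.2 ⟨fun b hb => ?_, fun b hb => upper p hp b hb⟩⟩
  filter_upwards [upper (-p) (UB_neg hp) (-b) (by rw [map_neg]; linarith)] with n hn
  change - (p (x n)) < _ at hn
  linarith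

theorem separable_case' {Y : Type*} [NormedAddCommGroup Y] [NormedSpace ℝ Y] [CompleteSpace Y]
    [TopologicalSpace.SeparableSpace Y]
    (hY : ¬ ∃ T : lp (fun _ : ℕ => ℝ) 1 →L[ℝ] Y, ∃ c : ℝ, 0 < c ∧
      ∀ f : lp (fun _ : ℕ => ℝ) 1, c * ‖f‖ ≤ ‖T f‖)
    (g : (Y →L[ℝ] ℝ) →ₗ[ℝ] ℝ) (M : ℝ) (hM : ∀ p, |g p| ≤ M * ‖p‖) :
    ∃ x : ℕ → Y, ∀ p : Y →L[ℝ] ℝ, Tendsto (fun n => p (x n)) atTop (𝓝 (g p)) := by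
  have hM0 : 0 ≤ |M| := abs_nonneg M
  obtain ⟨x, hx⟩ := separable_case hY (g ∘ₗ WeakDual.toStrongDual.toLinearMap) |M| (by
    intro p hp
    have h1 : ‖WeakDual.toStrongDual p‖ ≤ 1 :=
      ContinuousLinearMap.opNorm_le_bound _ zero_le_one fun x => by
        rw [one_mul]; exact UB_abs hp x
    have h2 := hM (WeakDual.toStrongDual p)
    calc g (WeakDual.toStrongDual p) ≤ M * ‖WeakDual.toStrongDual p‖ := (le_abs_self _).trans h2
      _ ≤ |M| * ‖WeakDual.toStrongDual p‖ :=
        mul_le_mul_of_nonneg_right (le_abs_self _) (norm_nonneg _)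
      _ ≤ |M| * 1 := mul_le_mul_of_nonneg_left h1 hM0
      _ = |M| := mul_one _)
    (TopologicalSpace.denseSeq Y) (TopologicalSpace.denseRange_denseSeq Y)
  refine ⟨x, fun p => ?_⟩
  have hk : 0 < ‖p‖ + 1 := by positivity
  have h := hx (StrongDual.toWeakDual ((‖p‖ + 1)⁻¹ • p)) (by
    intro y
    change (‖p‖ + 1)⁻¹ * p y ≤ _
    rw [inv_mul_le_iff₀ hk]
    have := (le_abs_self _).trans (p.le_opNorm y)
    nlinarith [norm_nonneg y])
  have h' : Tendsto (fun n => (‖p‖ + 1)⁻¹ * p (x n)) atTop (𝓝 (g ((‖p‖ + 1)⁻¹ • p))) := h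
  rw [map_smul, smul_eq_mul] at h'
  have h2 := h'.const_mul (‖p‖ + 1)
  simpa only [mul_inv_cancel_left₀ hk.ne'] using h2

theorem stmt6 {X : Type*} [NormedAddCommGroup X] [NormedSpace ℝ X] [CompleteSpace X]
    (hX : ¬ ∃ T : ellOne →L[ℝ] X, ∃ c : ℝ, 0 < c ∧ ∀ f : ellOne, c * ‖f‖ ≤ ‖T f‖) :
    B1 X = CX X := by
  apply Set.Subset.antisymm
  · rintro f ⟨x, hx⟩
    refine ⟨Set.range x, Set.countable_range x, ?_⟩
    letI := wstarTop (X →L[ℝ] ℝ)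
    change f ∈ closure _
    refine mem_closure_of_tendsto (f := fun n => NormedSpace.inclusionInDoubleDual ℝ X (x n))
      (b := atTop) ?_ (Eventually.of_forall fun n => ⟨x n, ⟨n, rfl⟩, rfl⟩)
    have hind : Topology.IsInducing (fun (f : (X →L[ℝ] ℝ) →L[ℝ] ℝ) (x : X →L[ℝ] ℝ) => f x) := ⟨rfl⟩
    rw [hind.tendsto_nhds_iff, tendsto_pi_nhds]
    exact hx
  · rintro f ⟨D, hD, hf⟩
    -- approximation property
    have happ : ∀ ξ : X →L[ℝ] ℝ, (∀ x ∈ D, ξ x = 0) → f ξ = 0 := by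
      intro ξ hξ
      letI := wstarTop (X →L[ℝ] ℝ)
      have hcont : Continuous (fun F : (X →L[ℝ] ℝ) →L[ℝ] ℝ => F ξ) :=
        (continuous_apply ξ).comp continuous_induced_dom
      have hcl : IsClosed {F : (X →L[ℝ] ℝ) →L[ℝ] ℝ | F ξ = 0} :=
        isClosed_eq hcont continuous_const
      refine closure_minimal ?_ hcl hf
      rintro _ ⟨x, hx, rfl⟩
      exact hξ x hx
    let Y : Submodule ℝ X := (Submodule.span ℝ D).topologicalClosure
    have hDY : ∀ x ∈ D, x ∈ Y := fun x hx =>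
      Submodule.le_topologicalClosure _ (Submodule.subset_span hx)
    have hYc : IsClosed (Y : Set X) := Submodule.isClosed_topologicalClosure _
    haveI : CompleteSpace Y := hYc.completeSpace_coe
    haveI : TopologicalSpace.SeparableSpace Y := by
      have : TopologicalSpace.IsSeparable (Y : Set X) :=
        (hD.isSeparable.span (R := ℝ)).closure
      exact this.separableSpace
    let R : (X →L[ℝ] ℝ) →ₗ[ℝ] (Y →L[ℝ] ℝ) :=
      { toFun := fun ξ => ξ.comp Y.subtypeL
        map_add' := fun _ _ => rfl
        map_smul' := fun _ _ => rfl }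
    have hext : ∀ φ : Y →L[ℝ] ℝ, ∃ ξ : X →L[ℝ] ℝ, R ξ = φ ∧ ‖ξ‖ = ‖φ‖ := by
      intro φ
      obtain ⟨ξ, h1, h2⟩ := _root_.exists_extension_norm_eq Y φ
      exact ⟨ξ, by ext y; exact h1 y, h2⟩
    obtain ⟨s, hs⟩ := R.exists_rightInverse_of_surjective
      (LinearMap.range_eq_top.2 fun φ => let ⟨ξ, h, _⟩ := hext φ; ⟨ξ, h⟩)
    have hs' : ∀ φ, R (s φ) = φ := fun φ => by
      have := LinearMap.congr_fun hs φ
      simpa using this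
    have hRf : ∀ ξ η, R ξ = R η → f ξ = f η := by
      intro ξ η h
      rw [← sub_eq_zero, ← map_sub]
      apply happ
      intro x hx
      have := congrArg (fun φ : Y →L[ℝ] ℝ => φ ⟨x, hDY x hx⟩) h
      change ξ x = η x at this
      simp [this]
    have hgR : ∀ ξ, f (s (R ξ)) = f ξ := fun ξ => hRf _ _ (hs' _)
    obtain ⟨x, hx⟩ := separable_case' (Y := Y) (by
      rintro ⟨T, c, hc, hT⟩
      exact hX ⟨Y.subtypeL.comp T, c, hc, hT⟩) (f.toLinearMap ∘ₗ s) ‖f‖ (by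
      intro φ
      obtain ⟨ξ, h1, h2⟩ := hext φ
      have : f (s φ) = f ξ := by rw [← hgR ξ, h1]
      change |f (s φ)| ≤ _
      rw [this, ← h2]
      exact f.le_opNorm ξ)
    refine ⟨fun n => x n, fun ξ => ?_⟩
    have := hx (R ξ)
    change Tendsto (fun n => ξ (x n)) atTop (𝓝 (f (s (R ξ)))) at this
    rwa [hgR] at this
end

section
/- Let X be a real Banach space that contains no isomorphic copy of ℓ¹, i.e., there is no continuous linear map T : ℓ¹ → X that is bounded below (∃ c > 0 with ‖T f‖ ≥ c‖f‖ for all f ∈ ℓ¹). Then for every A ⊆ X*, Ienv(A) equals the closure of conv(A) in the topology σ(X*,B₁(X)). -/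
open Filter Topology

/-- oscillation set -/
def oscSet {S : Type*} (f : ℕ → S → ℝ) (p q : ℝ) (F : Filter ℕ) : Set S :=
  {t | (∃ᶠ n in F, f n t < p) ∧ (∃ᶠ n in F, q < f n t)}

def cylSet {S : Type*} (f : ℕ → S → ℝ) (p q : ℝ) (P Q : Finset ℕ) : Set S :=
  {t | (∀ i ∈ P, f i t < p) ∧ (∀ i ∈ Q, q < f i t)}

lemma oscSet_mono {S : Type*} (f : ℕ → S → ℝ) (p q : ℝ) {F G : Filter ℕ} (h : F ≤ G) :
    oscSet f p q F ⊆ oscSet f p q G := fun _ ht => ⟨ht.1.filter_mono h, ht.2.filter_mono h⟩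

/-- Diagonal lemma. -/
lemma exists_stable_filter {ι : Type*} [Countable ι] [Nonempty ι] (R : ι → Filter ℕ → Prop)
    (hR : ∀ i F G, F ≤ G → R i G → R i F) :
    ∃ F : Filter ℕ, F ≤ atTop ∧ F.NeBot ∧ F.IsCountablyGenerated ∧
      ∀ i, R i F ∨ ∀ G ≤ F, G.NeBot → G.IsCountablyGenerated → ¬ R i G := by
  classical
  obtain ⟨e, he⟩ := exists_surjective_nat ι
  have step : ∀ (i : ι) (F : {F : Filter ℕ // F.NeBot ∧ F.IsCountablyGenerated}),
      ∃ G : {F : Filter ℕ // F.NeBot ∧ F.IsCountablyGenerated}, G.1 ≤ F.1 ∧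
        (R i G.1 ∨ ∀ H ≤ F.1, H.NeBot → H.IsCountablyGenerated → ¬ R i H) := by
    intro i F
    by_cases h : ∃ H ≤ F.1, H.NeBot ∧ H.IsCountablyGenerated ∧ R i H
    · obtain ⟨H, h1, h2, h3, h4⟩ := h
      exact ⟨⟨H, h2, h3⟩, h1, Or.inl h4⟩
    · push Not at h
      exact ⟨F, le_rfl, Or.inr h⟩
  choose nx hnx1 hnx2 using step
  let s : ℕ → {F : Filter ℕ // F.NeBot ∧ F.IsCountablyGenerated} := fun k =>
    Nat.rec ⟨atTop, inferInstance, inferInstance⟩ (fun k F => nx (e k) F) k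
  have hs : ∀ k, s (k+1) = nx (e k) (s k) := fun k => rfl
  have hanti : Antitone (fun k => (s k).1) :=
    antitone_nat_of_succ_le (fun k => by rw [hs]; exact hnx1 _ _)
  refine ⟨⨅ k, (s k).1, iInf_le_of_le 0 le_rfl, ?_, ?_, ?_⟩
  · exact iInf_neBot_of_directed' (hanti.directed_ge) (fun k => (s k).2.1)
  · have : ∀ k, (s k).1.IsCountablyGenerated := fun k => (s k).2.2
    infer_instance
  · intro i
    obtain ⟨k, rfl⟩ := he i
    rcases hnx2 (e k) (s k) with h | h
    · left
      exact hR _ _ _ (iInf_le _ (k+1)) (by rw [hs]; exact h)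
    · right
      intro G hG
      exact h G (hG.trans (iInf_le _ k))

/-- combinatorial dichotomy -/
lemma rosenthal_comb {S : Type*} (f : ℕ → S → ℝ) (C : ℝ) (hC : ∀ n t, |f n t| ≤ C) :
    (∃ u : ℕ → ℕ, Tendsto u atTop atTop ∧ ∀ t, ∃ c, Tendsto (fun n => f (u n) t) atTop (𝓝 c)) ∨
    ∃ (p q : ℝ) (g : ℕ → ℕ), p < q ∧ Function.Injective g ∧ ∀ N, ∀ P ⊆ Finset.range N,
      ∃ t, (∀ i ∈ P, f (g i) t < p) ∧ ∀ i ∈ Finset.range N \ P, q < f (g i) t := by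
  classical
  obtain ⟨F, hFtop, hFne, hFc, hst⟩ := exists_stable_filter
    (ι := ℚ × ℚ × Finset ℕ × Finset ℕ)
    (fun i F => oscSet f i.1 i.2.1 F ∩ cylSet f i.1 i.2.1 i.2.2.1 i.2.2.2 = ∅)
    (by
      intro i F G h hG
      exact Set.subset_eq_empty (Set.inter_subset_inter_left _ (oscSet_mono f _ _ h)) hG)
  by_cases hconv : ∀ t, ∃ c, Tendsto (fun n => f n t) F (𝓝 c)
  · left
    obtain ⟨u, hu⟩ := F.exists_seq_tendsto
    refine ⟨u, hu.mono_right hFtop, fun t => ?_⟩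
    obtain ⟨c, hc⟩ := hconv t
    exact ⟨c, hc.comp hu⟩
  right
  push Not at hconv
  obtain ⟨t₀, ht₀⟩ := hconv
  have : ∃ p q : ℚ, p < q ∧ t₀ ∈ oscSet f p q F := by
    by_contra hcon
    push Not at hcon
    have := tendsto_of_no_upcrossings (f := F) (u := fun n => f n t₀)
      (s := Set.range ((↑) : ℚ → ℝ)) Rat.denseRange_cast ?_ ?_ ?_
    · obtain ⟨c, hc⟩ := this
      exact ht₀ c hc
    · rintro _ ⟨a, rfl⟩ _ ⟨b, rfl⟩ hab h
      exact hcon a b (by exact_mod_cast hab) h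
    · exact isBoundedUnder_of ⟨C, fun n => (abs_le.1 (hC n t₀)).2⟩
    · exact isBoundedUnder_of ⟨-C, fun n => (abs_le.1 (hC n t₀)).1⟩
  obtain ⟨p, q, hpq, hosc⟩ := this
  let Great : Finset ℕ → Finset ℕ → Prop := fun P Q =>
    ∀ G ≤ F, G.NeBot → G.IsCountablyGenerated → (oscSet f p q G ∩ cylSet f p q P Q).Nonempty
  have hgreat : ∀ P Q, (oscSet f p q F ∩ cylSet f p q P Q).Nonempty → Great P Q := by
    intro P Q h
    rcases hst (p, q, P, Q) with h' | h'
    · exact absurd h' h.ne_empty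
    · intro G h1 h2 h3
      exact Set.nonempty_iff_ne_empty.2 (h' G h1 h2 h3)
  have hgreat0 : Great ∅ ∅ := hgreat _ _ ⟨t₀, hosc, by simp [cylSet]⟩
  have key : ∀ T : Finset (Finset ℕ × Finset ℕ), (∀ x ∈ T, Great x.1 x.2) →
      ∃ G ≤ F, G.NeBot ∧ G.IsCountablyGenerated ∧
        ∀ᶠ n in G, ∀ x ∈ T, Great (insert n x.1) x.2 ∧ Great x.1 (insert n x.2) := by
    intro T
    induction T using Finset.induction_on with
    | empty => intro _; exact ⟨F, le_rfl, hFne, hFc, by simp⟩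
    | insert x T hx ih =>
      intro hT
      obtain ⟨G, hGF, hG1, hG2, hG3⟩ := ih (fun y hy => hT y (Finset.mem_insert_of_mem hy))
      have hxg := hT x (Finset.mem_insert_self _ _)
      obtain ⟨t, ht1, ht2⟩ := hxg G hGF hG1 hG2
      have hH1 : (G ⊓ 𝓟 {n | f n t < p}).NeBot := frequently_mem_iff_neBot.1 ht1.1
      obtain ⟨t', ht1', ht2'⟩ := hxg (G ⊓ 𝓟 {n | f n t < p}) (inf_le_left.trans hGF) hH1
        inferInstance
      refine ⟨G ⊓ 𝓟 {n | f n t < p} ⊓ 𝓟 {n | q < f n t'}, inf_le_left.trans (inf_le_left.trans hGF),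
        frequently_mem_iff_neBot.1 ht1'.2, inferInstance, ?_⟩
      have e1 : ∀ᶠ n in G ⊓ 𝓟 {n | f n t < p} ⊓ 𝓟 {n | q < f n t'}, f n t < p :=
        mem_inf_of_left (mem_inf_of_right (mem_principal_self _))
      have e2 : ∀ᶠ n in G ⊓ 𝓟 {n | f n t < p} ⊓ 𝓟 {n | q < f n t'}, q < f n t' :=
        mem_inf_of_right (mem_principal_self _)
      filter_upwards [e1, e2, hG3.filter_mono (inf_le_left.trans inf_le_left)] with n h1 h2 h3
      intro y hy
      rcases Finset.mem_insert.1 hy with rfl | hy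
      · constructor
        · refine hgreat _ _ ⟨t, oscSet_mono f _ _ hGF ht1, ?_, ht2.2⟩
          intro i hi
          rcases Finset.mem_insert.1 hi with rfl | hi
          · exact h1
          · exact ht2.1 i hi
        · refine hgreat _ _ ⟨t', oscSet_mono f _ _ (inf_le_left.trans hGF) ht1', ht2'.1, ?_⟩
          intro i hi
          rcases Finset.mem_insert.1 hi with rfl | hi
          · exact h2
          · exact ht2'.2 i hi
      · exact h3 y hy
  let Inv : Finset ℕ → Prop := fun s => ∀ P ⊆ s, Great P (s \ P)
  have step : ∀ s : {s // Inv s}, ∃ n, n ∉ s.1 ∧ Inv (insert n s.1) := by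
    rintro ⟨s, hs⟩
    obtain ⟨G, hGF, hG1, hG2, hG3⟩ := key (s.powerset.image (fun P => (P, s \ P))) (by
      intro x hx
      obtain ⟨P, hP, rfl⟩ := Finset.mem_image.1 hx
      exact hs P (Finset.mem_powerset.1 hP))
    have hlarge : ∀ᶠ n in G, n ∉ s := by
      have : ∀ᶠ n in atTop, n ∉ s := by
        rw [← Nat.cofinite_eq_atTop]
        exact s.finite_toSet.eventually_cofinite_notMem
      exact this.filter_mono (hGF.trans hFtop)
    obtain ⟨n, h1, h2⟩ := (hG3.and hlarge).exists
    refine ⟨n, h2, ?_⟩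
    intro P hP
    by_cases hn : n ∈ P
    · have := (h1 (P.erase n, s \ P.erase n) (Finset.mem_image.2 ⟨P.erase n, by
        rw [Finset.mem_powerset]; grind, rfl⟩)).1
      have e : s \ P.erase n = insert n s \ P := by grind
      simpa [Finset.insert_erase hn, e] using this
    · have := (h1 (P, s \ P) (Finset.mem_image.2 ⟨P, by
        rw [Finset.mem_powerset]; grind, rfl⟩)).2
      have e : insert n (s \ P) = insert n s \ P := by grind
      simpa [e] using this
  choose nx hnx1 hnx2 using step
  let s : ℕ → {s // Inv s} := fun k =>
    Nat.rec ⟨∅, by intro P hP; simpa [Finset.subset_empty.1 hP] using hgreat0⟩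
      (fun _ s => ⟨insert (nx s) s.1, hnx2 s⟩) k
  let g : ℕ → ℕ := fun k => nx (s k)
  have hs0 : (s 0).1 = ∅ := rfl
  have hs : ∀ k, (s (k+1)).1 = insert (g k) (s k).1 := fun k => rfl
  have himg : ∀ k, (s k).1 = (Finset.range k).image g := by
    intro k
    induction k with
    | zero => simp [hs0]
    | succ k ih => rw [hs, ih, Finset.range_add_one, Finset.image_insert]
  have hginj : Function.Injective g := by
    have : ∀ a b, a < b → g a ≠ g b := by
      intro a b hab h
      have h1 : g b ∉ (s b).1 := hnx1 (s b)
      rw [himg] at h1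
      exact h1 (Finset.mem_image.2 ⟨a, Finset.mem_range.2 hab, h⟩)
    intro a b h
    by_contra hne
    rcases lt_or_gt_of_ne hne with h' | h'
    · exact this _ _ h' h
    · exact this _ _ h' h.symm
  refine ⟨p, q, g, by exact_mod_cast hpq, hginj, ?_⟩
  intro N P hP
  have h1 := (s N).2 (P.image g) (by rw [himg]; exact Finset.image_subset_image hP)
  obtain ⟨t, -, ht⟩ := h1 F le_rfl hFne hFc
  refine ⟨t, fun i hi => ht.1 _ (Finset.mem_image_of_mem g hi), fun i hi => ht.2 _ ?_⟩
  rw [himg, ← Finset.image_sdiff _ _ hginj]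
  exact Finset.mem_image_of_mem g hi

lemma l1_embed {X : Type*} [NormedAddCommGroup X] [NormedSpace ℝ X] [CompleteSpace X]
    (y : ℕ → X) (hy : ∀ n, ‖y n‖ ≤ 1) (d : ℝ) (hd : 0 < d)
    (hl : ∀ N (c : ℕ → ℝ), d * ∑ i ∈ Finset.range N, |c i| ≤ ‖∑ i ∈ Finset.range N, c i • y i‖) :
    ∃ T : ellOne →L[ℝ] X, ∃ c : ℝ, 0 < c ∧ ∀ f : ellOne, c * ‖f‖ ≤ ‖T f‖ := by
  have hn : ∀ f : ellOne, HasSum (fun i => |f i|) ‖f‖ := by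
    intro f
    have := lp.hasSum_norm (p := 1) (by simp) f
    simpa using this
  have hle : ∀ (f : ellOne) i, ‖f i • y i‖ ≤ |f i| := by
    intro f i
    rw [norm_smul, Real.norm_eq_abs]
    exact mul_le_of_le_one_right (abs_nonneg _) (hy i)
  have hsum : ∀ f : ellOne, Summable (fun i => f i • y i) := fun f =>
    Summable.of_norm_bounded (hn f).summable (hle f)
  let T0 : ellOne →ₗ[ℝ] X :=
    { toFun := fun f => ∑' i, f i • y i
      map_add' := by
        intro f g
        rw [← (hsum f).tsum_add (hsum g)]
        congr 1; ext i
        simp [add_smul]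
      map_smul' := by
        intro a f
        simp only [RingHom.id_apply]
        rw [← (hsum f).tsum_const_smul a]
        congr 1; ext i
        simp [mul_smul] }
  refine ⟨T0.mkContinuous 1 ?_, d, hd, ?_⟩
  · intro f
    rw [one_mul]
    exact tsum_of_norm_bounded (hn f) (hle f)
  · intro f
    have h1 : Tendsto (fun N => d * ∑ i ∈ Finset.range N, |f i|) atTop (𝓝 (d * ‖f‖)) :=
      (hn f).tendsto_sum_nat.const_mul d
    have h2 : Tendsto (fun N => ‖∑ i ∈ Finset.range N, f i • y i‖) atTop (𝓝 ‖T0 f‖) :=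
      (hsum f).hasSum.tendsto_sum_nat.norm
    exact le_of_tendsto_of_tendsto' h1 h2 (fun N => hl N _)

lemma rosenthal_banach {X : Type*} [NormedAddCommGroup X] [NormedSpace ℝ X] [CompleteSpace X]
    (hX : ¬ ∃ T : ellOne →L[ℝ] X, ∃ c : ℝ, 0 < c ∧ ∀ f : ellOne, c * ‖f‖ ≤ ‖T f‖)
    (x : ℕ → X) (hx : ∀ n, ‖x n‖ ≤ 1) :
    ∃ u : ℕ → ℕ, Tendsto u atTop atTop ∧ ∃ F : (X →L[ℝ] ℝ) →L[ℝ] ℝ,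
      ∀ ξ : X →L[ℝ] ℝ, Tendsto (fun n => ξ (x (u n))) atTop (𝓝 (F ξ)) := by
  classical
  rcases rosenthal_comb (S := {ξ : X →L[ℝ] ℝ // ‖ξ‖ ≤ 1}) (fun n ξ => ξ.1 (x n)) 1 (by
    rintro n ⟨ξ, hξ⟩
    have := ξ.le_opNorm (x n)
    rw [Real.norm_eq_abs] at this
    have h2 : ‖ξ‖ * ‖x n‖ ≤ 1 := mul_le_one₀ hξ (norm_nonneg _) (hx n)
    exact this.trans h2) with ⟨u, hu, hconv⟩ | ⟨p, q, g, hpq, -, hind⟩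
  · refine ⟨u, hu, ?_⟩
    have hall : ∀ ξ : X →L[ℝ] ℝ, ∃ c, Tendsto (fun n => ξ (x (u n))) atTop (𝓝 c) := by
      intro ξ
      have hpos : 0 < ‖ξ‖ + 1 := by positivity
      obtain ⟨c, hc⟩ := hconv ⟨(‖ξ‖ + 1)⁻¹ • ξ, by
        rw [norm_smul, norm_inv, Real.norm_of_nonneg hpos.le, inv_mul_le_iff₀ hpos]; linarith⟩
      refine ⟨(‖ξ‖ + 1) * c, (hc.const_mul (‖ξ‖ + 1)).congr fun n => ?_⟩
      simp only [_root_.smul_apply, smul_eq_mul]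
      field_simp
    choose F hF using hall
    refine ⟨continuousLinearMapOfTendsto (l := atTop)
      (fun n => NormedSpace.inclusionInDoubleDual ℝ X (x (u n))) (f := F)
      (tendsto_pi_nhds.2 fun ξ => hF ξ), fun ξ => hF ξ⟩
  · exfalso
    apply hX
    refine l1_embed (fun n => x (g n)) (fun n => hx _) ((q - p) / 2) (by linarith) ?_
    intro N c
    set w := ∑ i ∈ Finset.range N, c i • x (g i) with hw
    obtain ⟨⟨t, ht⟩, h1, h2⟩ := hind N ((Finset.range N).filter (fun i => c i < 0))
      (Finset.filter_subset _ _)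
    obtain ⟨⟨t', ht'⟩, h1', h2'⟩ := hind N ((Finset.range N).filter (fun i => ¬ c i < 0))
      (Finset.filter_subset _ _)
    have hb : ∀ s : X →L[ℝ] ℝ, ‖s‖ ≤ 1 → |s w| ≤ ‖w‖ := by
      intro s hs
      have := s.le_of_opNorm_le hs w
      simpa using this
    have hdiff : (q - p) * ∑ i ∈ Finset.range N, |c i| ≤ t w - t' w := by
      rw [hw, map_sum, map_sum, ← Finset.sum_sub_distrib, Finset.mul_sum]
      refine Finset.sum_le_sum fun i hi => ?_
      simp only [map_smul, smul_eq_mul]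
      by_cases hc : c i < 0
      · have a1 := h1 i (by simp only [Finset.mem_filter]; exact ⟨hi, hc⟩)
        have a2 := h2' i (by simp only [Finset.mem_sdiff, Finset.mem_filter]; tauto)
        simp only at a1 a2
        rw [abs_of_neg hc]; nlinarith
      · have a1 := h1' i (by simp only [Finset.mem_filter]; exact ⟨hi, hc⟩)
        have a2 := h2 i (by simp only [Finset.mem_sdiff, Finset.mem_filter]; tauto)
        simp only at a1 a2
        rw [abs_of_nonneg (not_lt.1 hc)]; nlinarith
    have k1 := (abs_le.1 (hb t ht)).2
    have k2 := (abs_le.1 (hb t' ht')).1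
    linarith

lemma compact_hull {E : Type*} [AddCommGroup E] [Module ℝ E] [TopologicalSpace E]
    [IsTopologicalAddGroup E] [ContinuousSMul ℝ E] {s t : Set E} (hs : IsCompact s)
    (ht : IsCompact t) (hs' : Convex ℝ s) (ht' : Convex ℝ t) :
    IsCompact (convexHull ℝ (s ∪ t)) := by
  rcases s.eq_empty_or_nonempty with rfl | hsn
  · simpa [ht'.convexHull_eq] using ht
  rcases t.eq_empty_or_nonempty with rfl | htn
  · simpa [hs'.convexHull_eq] using hs
  rw [hs'.convexHull_union ht' hsn htn]
  have : convexJoin ℝ s t =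
      (fun z : (E × E) × ℝ => (1 - z.2) • z.1.1 + z.2 • z.1.2) '' ((s ×ˢ t) ×ˢ Set.Icc 0 1) := by
    ext z
    simp only [mem_convexJoin, segment_eq_image, Set.mem_image, Set.mem_prod, Prod.exists]
    constructor
    · rintro ⟨a, ha, b, hb, θ, hθ, rfl⟩
      exact ⟨a, b, θ, ⟨⟨ha, hb⟩, hθ⟩, rfl⟩
    · rintro ⟨a, b, θ, ⟨⟨ha, hb⟩, hθ⟩, rfl⟩
      exact ⟨a, ha, b, hb, θ, hθ, rfl⟩
  rw [this]
  exact ((hs.prod ht).prod isCompact_Icc).image (by fun_prop)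

lemma compact_hull_fin {E : Type*} [AddCommGroup E] [Module ℝ E] [TopologicalSpace E]
    [IsTopologicalAddGroup E] [ContinuousSMul ℝ E] (C : ℕ → Set E) (hC : ∀ k, IsCompact (C k))
    (hC' : ∀ k, Convex ℝ (C k)) (n : ℕ) :
    IsCompact (convexHull ℝ (⋃ k < n, C k)) := by
  induction n with
  | zero => simp
  | succ n ih =>
    rw [Set.biUnion_lt_succ, ← convexHull_convexHull_union_left]
    exact compact_hull ih (hC n) (convex_convexHull _ _) (hC' n)

lemma weak_sep {X : Type*} [NormedAddCommGroup X] [NormedSpace ℝ X]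
    (ξ₀ : WeakDual ℝ X) (δ : ℝ) (hδ : 0 < δ) (K : Set (WeakDual ℝ X)) (hK : IsCompact K)
    (hKc : Convex ℝ K)
    (hdis : ∀ ξ ∈ K, δ < ‖WeakDual.toStrongDual ξ - WeakDual.toStrongDual ξ₀‖) :
    ∃ x : X, ‖x‖ ≤ 1 ∧ ∀ ξ ∈ K, ξ₀ x + δ ≤ ξ x := by
  have : LocallyConvexSpace ℝ (WeakDual ℝ X) :=
    inferInstanceAs (LocallyConvexSpace ℝ (WeakBilin (topDualPairing ℝ X)))
  obtain ⟨f, u, v, h1, huv, h2⟩ := geometric_hahn_banach_compact_closed (E := WeakDual ℝ X)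
    (s := WeakDual.toStrongDual ⁻¹' Metric.closedBall (WeakDual.toStrongDual ξ₀) δ)
    ((convex_closedBall _ _).linear_preimage _)
    (WeakDual.isCompact_closedBall (𝕜 := ℝ) _ _) hKc hK.isClosed (by
      rw [Set.disjoint_left]
      intro a ha haK
      have := hdis a haK
      simp only [Set.mem_preimage, mem_closedBall_iff_norm] at ha
      linarith)
  obtain ⟨x, hx⟩ := LinearMap.dualEmbedding_surjective (topDualPairing ℝ X) f
  have hfx : ∀ ξ : WeakDual ℝ X, f ξ = ξ x := by
    intro ξ; rw [← hx]; rfl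
  obtain ⟨η, hη1, hη2⟩ := exists_dual_vector'' ℝ x
  have h3 : ξ₀ x + δ * ‖x‖ < u := by
    have := h1 (StrongDual.toWeakDual (WeakDual.toStrongDual ξ₀ + δ • η)) (by
      simp only [Set.mem_preimage, mem_closedBall_iff_norm]
      have e : WeakDual.toStrongDual (StrongDual.toWeakDual (WeakDual.toStrongDual ξ₀ + δ • η))
        - WeakDual.toStrongDual ξ₀ = δ • η := by simp
      rw [e, norm_smul, Real.norm_of_nonneg hδ.le]
      exact mul_le_of_le_one_right hδ.le hη1)
    rw [hfx] at this
    have e2 : (StrongDual.toWeakDual (WeakDual.toStrongDual ξ₀ + δ • η)) x = ξ₀ x + δ * η x := rfl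
    rw [e2, hη2] at this
    simpa using this
  rcases eq_or_ne x 0 with rfl | hx0
  · refine ⟨0, by simp, fun ξ hξ => ?_⟩
    have := h2 ξ hξ
    rw [hfx] at this
    simp at h3 this
    linarith
  · have hpos : 0 < ‖x‖ := norm_pos_iff.2 hx0
    refine ⟨‖x‖⁻¹ • x, by rw [norm_smul, norm_inv, norm_norm, inv_mul_cancel₀ hpos.ne'], fun ξ hξ => ?_⟩
    have h4 := h2 ξ hξ
    rw [hfx] at h4
    rw [map_smul, map_smul, smul_eq_mul, smul_eq_mul]
    have h5 : ξ₀ x + δ * ‖x‖ ≤ ξ x := by linarith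
    calc ‖x‖⁻¹ * ξ₀ x + δ = ‖x‖⁻¹ * (ξ₀ x + δ * ‖x‖) := by field_simp
      _ ≤ _ := mul_le_mul_of_nonneg_left h5 (by positivity)

lemma dir_two {X : Type*} [NormedAddCommGroup X] [NormedSpace ℝ X] [CompleteSpace X]
    (hX : ¬ ∃ T : ellOne →L[ℝ] X, ∃ c : ℝ, 0 < c ∧ ∀ f : ellOne, c * ‖f‖ ≤ ‖T f‖)
    (A : Set (X →L[ℝ] ℝ)) :
    @closure _ (sigmaTop (B1 X)) (convexHull ℝ A) ⊆ Ienv A := by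
  intro ξ₀ hξ₀
  simp only [Ienv, Set.mem_iInter]
  intro As hA
  by_contra hnot
  rw [Metric.mem_closure_iff] at hnot
  push Not at hnot
  obtain ⟨ε, hε, hdist⟩ := hnot
  let C : ℕ → Set (WeakDual ℝ X) := fun k =>
    closure (convexHull ℝ (WeakDual.toStrongDual ⁻¹'
      (As k.unpair.1 ∩ Metric.closedBall 0 (k.unpair.2 : ℝ))))
  have hCc : ∀ k, Convex ℝ (C k) := fun k => (convex_convexHull ℝ _).closure
  have hCk : ∀ k, IsCompact (C k) := by
    intro k
    have hball := WeakDual.isCompact_closedBall (𝕜 := ℝ) (0 : StrongDual ℝ X) (k.unpair.2 : ℝ)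
    refine hball.of_isClosed_subset isClosed_closure
      (closure_minimal (convexHull_min ?_ ((convex_closedBall _ _).linear_preimage _)) hball.isClosed)
    exact fun a ha => ha.2
  have hCsub : ∀ k, C k ⊆ (wstarClosure (convexHull ℝ (As k.unpair.1)) : Set (X →L[ℝ] ℝ)) := by
    intro k
    exact @closure_mono _ (wstarTop X) _ _ (convexHull_mono (fun a ha => ha.1))
  let K : ℕ → Set (WeakDual ℝ X) := fun n => convexHull ℝ (⋃ k < n, C k)
  have hKsub : ∀ n, K n ⊆ (convexHull ℝ (⋃ n, wstarClosure (convexHull ℝ (As n))) :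
      Set (X →L[ℝ] ℝ)) := by
    intro n
    refine convexHull_mono (𝕜 := ℝ) (E := X →L[ℝ] ℝ) ?_
    exact Set.iUnion₂_subset fun k _ => (hCsub k).trans (Set.subset_iUnion_of_subset _ subset_rfl)
  have hsep : ∀ n, ∃ x : X, ‖x‖ ≤ 1 ∧ ∀ ξ ∈ K n, ξ₀ x + ε / 2 ≤ ξ x := by
    intro n
    refine weak_sep (StrongDual.toWeakDual ξ₀) (ε / 2) (by linarith) (K n)
      (compact_hull_fin C hCk hCc n) (convex_convexHull _ _) ?_
    intro ξ hξ
    have := hdist (WeakDual.toStrongDual ξ) (hKsub n hξ)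
    rw [dist_comm, dist_eq_norm] at this
    have e : WeakDual.toStrongDual (StrongDual.toWeakDual ξ₀) = ξ₀ := rfl
    rw [e]
    have this' : ε ≤ ‖WeakDual.toStrongDual ξ - ξ₀‖ := this
    linarith
  choose x hx1 hx2 using hsep
  obtain ⟨u, hu, F, hF⟩ := rosenthal_banach hX x hx1
  have hFB : F ∈ B1 X := ⟨fun n => x (u n), hF⟩
  have hAF : ∀ ξ ∈ A, F ξ₀ + ε / 2 ≤ F ξ := by
    intro ξ hξ
    rw [hA] at hξ
    obtain ⟨i, hi⟩ := Set.mem_iUnion.1 hξ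
    obtain ⟨j, hj⟩ := exists_nat_ge ‖ξ‖
    refine le_of_tendsto_of_tendsto ((hF ξ₀).add_const (ε / 2)) (hF ξ) ?_
    filter_upwards [hu.eventually_gt_atTop (Nat.pair i j)] with n hn
    refine hx2 (u n) (StrongDual.toWeakDual ξ) (subset_convexHull ℝ _ ?_)
    refine Set.mem_iUnion₂.2 ⟨Nat.pair i j, hn, subset_closure (subset_convexHull ℝ _ ?_)⟩
    simp only [Set.mem_preimage, Nat.unpair_pair]
    exact ⟨hi, by simpa using! hj⟩
  have hcont : @Continuous _ _ (sigmaTop (B1 X)) _ (fun ξ : X →L[ℝ] ℝ => F ξ) := by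
    have h1 : Continuous[sigmaTop (B1 X), Pi.topologicalSpace]
        (fun (f : X →L[ℝ] ℝ) (y : B1 X) => y.1 f) := continuous_induced_dom
    have h2 : Continuous (fun p : B1 X → ℝ => p ⟨F, hFB⟩) := continuous_apply _
    have h3 := @Continuous.comp _ _ _ (sigmaTop (B1 X)) _ _
      (fun (f : X →L[ℝ] ℝ) (y : B1 X) => y.1 f) (fun p : B1 X → ℝ => p ⟨F, hFB⟩) h2 h1
    exact h3
  have hclosed : @IsClosed _ (sigmaTop (B1 X)) {ξ : X →L[ℝ] ℝ | F ξ₀ + ε / 2 ≤ F ξ} :=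
    @IsClosed.preimage _ _ (sigmaTop (B1 X)) _ _ hcont _ (isClosed_Ici (a := F ξ₀ + ε / 2))
  have hconv : Convex ℝ {ξ : X →L[ℝ] ℝ | F ξ₀ + ε / 2 ≤ F ξ} :=
    convex_halfSpace_ge F.toLinearMap.isLinear _
  have hsub : @closure _ (sigmaTop (B1 X)) (convexHull ℝ A) ⊆
      {ξ : X →L[ℝ] ℝ | F ξ₀ + ε / 2 ≤ F ξ} :=
    @closure_minimal _ (sigmaTop (B1 X)) _ _ (convexHull_min hAF hconv) hclosed
  have : F ξ₀ + ε / 2 ≤ F ξ₀ := hsub hξ₀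
  linarith

lemma bilin_sep {E F : Type*} [AddCommGroup E] [Module ℝ E] [AddCommGroup F] [Module ℝ F]
    (B : E →ₗ[ℝ] F →ₗ[ℝ] ℝ) (C : Set E) (hC : Convex ℝ C) (x : E)
    (h : x ∉ @closure _ (TopologicalSpace.induced (fun x y => B x y) Pi.topologicalSpace) C) :
    ∃ (y : F) (u : ℝ), (∀ a ∈ C, B a y < u) ∧ u < B x y := by
  let C' : Set (WeakBilin B) := C
  have hC' : Convex ℝ C' := hC
  obtain ⟨f, u, h1, h2⟩ := geometric_hahn_banach_closed_point (E := WeakBilin B) (x := x)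
    (s := closure C') hC'.closure isClosed_closure h
  obtain ⟨y, hy⟩ := LinearMap.dualEmbedding_surjective B f
  have hf : ∀ a : E, f a = B a y := by
    intro a; rw [← hy]; rfl
  refine ⟨y, u, fun a ha => ?_, ?_⟩
  · rw [← hf]; exact h1 a (subset_closure ha)
  · rw [← hf]; exact h2

lemma bilin_sep_set {E W : Type*} [AddCommGroup E] [Module ℝ E] [AddCommGroup W] [Module ℝ W]
    (B : E →ₗ[ℝ] W →ₗ[ℝ] ℝ) (S : Set W) (h0 : (0 : W) ∈ S)
    (hadd : ∀ {a b : W}, a ∈ S → b ∈ S → a + b ∈ S)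
    (hsmul : ∀ (c : ℝ) {a : W}, a ∈ S → c • a ∈ S) (C : Set E) (hC : Convex ℝ C) (x : E)
    (h : x ∉ @closure _ (TopologicalSpace.induced (fun x (y : S) => B x y.1)
      Pi.topologicalSpace) C) :
    ∃ y ∈ S, ∃ u : ℝ, (∀ a ∈ C, B a y < u) ∧ u < B x y := by
  let M : Submodule ℝ W :=
    { carrier := S, add_mem' := hadd, zero_mem' := h0, smul_mem' := hsmul }
  let B' : E →ₗ[ℝ] M →ₗ[ℝ] ℝ := B.compl₂ M.subtype
  obtain ⟨y, u, h1, h2⟩ := bilin_sep B' C hC x h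
  exact ⟨y.1, y.2, u, h1, h2⟩

lemma sigma_sep {X : Type*} [NormedAddCommGroup X] [NormedSpace ℝ X]
    (C : Set (X →L[ℝ] ℝ)) (hC : Convex ℝ C) (ξ₀ : X →L[ℝ] ℝ)
    (h : ξ₀ ∉ @closure _ (sigmaTop (B1 X)) C) :
    ∃ F ∈ B1 X, ∃ u : ℝ, (∀ ξ ∈ C, F ξ < u) ∧ u < F ξ₀ := by
  let B : (X →L[ℝ] ℝ) →ₗ[ℝ] ((X →L[ℝ] ℝ) →L[ℝ] ℝ) →ₗ[ℝ] ℝ :=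
    LinearMap.mk₂ ℝ (fun ξ F => F ξ) (fun a b F => map_add F a b) (fun c a F => map_smul F c a)
      (fun _ _ _ => rfl) (fun _ _ _ => rfl)
  have key := bilin_sep_set (E := X →L[ℝ] ℝ) (W := (X →L[ℝ] ℝ) →L[ℝ] ℝ) B (B1 X)
    ⟨fun _ => 0, fun ξ => by simp⟩
  refine key ?_ ?_ C hC ξ₀ h
  · rintro F G ⟨x, hx⟩ ⟨y, hy⟩
    exact ⟨fun n => x n + y n, fun ξ => by simpa using (hx ξ).add (hy ξ)⟩
  · rintro c F ⟨x, hx⟩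
    exact ⟨fun n => c • x n, fun ξ => by simpa using (hx ξ).const_mul c⟩

lemma dir_one {X : Type*} [NormedAddCommGroup X] [NormedSpace ℝ X]
    (A : Set (X →L[ℝ] ℝ)) :
    Ienv A ⊆ @closure _ (sigmaTop (B1 X)) (convexHull ℝ A) := by
  intro ξ₀ hξ₀
  by_contra hnot
  obtain ⟨F, ⟨x, hx⟩, c, h1, h2⟩ := sigma_sep _ (convex_convexHull ℝ A) ξ₀ hnot
  simp only [Ienv, Set.mem_iInter] at hξ₀
  have := hξ₀ (fun n => {ξ ∈ A | ∀ k ≥ n, ξ (x k) ≤ c}) (by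
    ext ξ
    simp only [Set.mem_iUnion, Set.mem_ofPred_eq]
    constructor
    · intro hξ
      have : ∀ᶠ k in atTop, ξ (x k) < c := (hx ξ).eventually_lt_const (h1 ξ (subset_convexHull ℝ _ hξ))
      obtain ⟨n, hn⟩ := eventually_atTop.1 this
      exact ⟨n, hξ, fun k hk => (hn k hk).le⟩
    · rintro ⟨n, h, -⟩
      exact h)
  have hsub : closure (convexHull ℝ (⋃ n, wstarClosure (convexHull ℝ
      {ξ ∈ A | ∀ k ≥ n, ξ (x k) ≤ c}))) ⊆ {ξ : X →L[ℝ] ℝ | F ξ ≤ c} := by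
    refine closure_minimal (convexHull_min (Set.iUnion_subset fun n => ?_)
      (convex_halfSpace_le F.toLinearMap.isLinear _)) (isClosed_Iic.preimage F.continuous)
    have hcl : @IsClosed _ (wstarTop X) {ξ : X →L[ℝ] ℝ | ∀ k ≥ n, ξ (x k) ≤ c} := by
      have : IsClosed {ξ : WeakDual ℝ X | ∀ k ≥ n, ξ (x k) ≤ c} := by
        simp only [Set.ofPred_forall]
        exact isClosed_iInter fun k => isClosed_iInter fun _ =>
          isClosed_Iic.preimage (WeakDual.eval_continuous (x k))
      exact this
    have hcv : Convex ℝ {ξ : X →L[ℝ] ℝ | ∀ k ≥ n, ξ (x k) ≤ c} := by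
      intro a ha b hb s t hs ht hst k hk
      have h1 := ha k hk
      have h2 := hb k hk
      change s * a (x k) + t * b (x k) ≤ c
      calc s * a (x k) + t * b (x k) ≤ s * c + t * c := by gcongr
        _ = c := by rw [← add_mul, hst, one_mul]
    have hin : wstarClosure (convexHull ℝ {ξ ∈ A | ∀ k ≥ n, ξ (x k) ≤ c}) ⊆
        {ξ : X →L[ℝ] ℝ | ∀ k ≥ n, ξ (x k) ≤ c} :=
      @closure_minimal _ (wstarTop X) _ _ (convexHull_min (fun ξ hξ => hξ.2) hcv) hcl
    intro ξ hξ
    exact le_of_tendsto (hx ξ) (eventually_atTop.2 ⟨n, hin hξ⟩)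
  have := hsub this
  simp only [Set.mem_ofPred_eq] at this
  linarith

theorem stmt7 {X : Type*} [NormedAddCommGroup X] [NormedSpace ℝ X] [CompleteSpace X]
    (hX : ¬ ∃ T : ellOne →L[ℝ] X, ∃ c : ℝ, 0 < c ∧ ∀ f : ellOne, c * ‖f‖ ≤ ‖T f‖) :
    ∀ A : Set (X →L[ℝ] ℝ),
      Ienv A = @closure _ (sigmaTop (B1 X)) (convexHull ℝ A) := by
  exact fun A => Set.Subset.antisymm (dir_one A) (dir_two hX A)
end
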